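/- Let ρ, J, S, φ : ℝ × ℝ → ℝ be three times continuously differentiable functions of (x,t) satisfying, for all x ∈ ℝ and all t ≥ 0: (i) the continuity equation ∂_t ρ + ∂_x J = 0; (ii) the momentum equation ∂_t J + ∂_x S = ρ ∂_x φ; (iii) the quasi-neutral reformulated Poisson equation ∂_x(ρ ∂_x φ) = ∂_{xx} S. Then for all x ∈ ℝ and t ≥ 0 one has ∂_x J(x,t) = ∂_x J(x,0) and ρ(x,t) = ρ(x,0) − t · ∂_x J(x,0). -/

import Mathlib

/-- Spatial partial derivative of a function of `(x, t)`. -/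
noncomputable def pdx (f : ℝ × ℝ → ℝ) (x t : ℝ) : ℝ := deriv (fun y => f (y, t)) x

/-- Temporal partial derivative of a function of `(x, t)`. -/
noncomputable def pdt (f : ℝ × ℝ → ℝ) (x t : ℝ) : ℝ := deriv (fun s => f (x, s)) t

/-- Second spatial partial derivative of a function of `(x, t)`. -/
noncomputable def pdxx (f : ℝ × ℝ → ℝ) (x t : ℝ) : ℝ := deriv (fun y => pdx f y t) x

lemma hasDerivAt_slice_fst {f : ℝ × ℝ → ℝ} {x t : ℝ} (hf : DifferentiableAt ℝ f (x, t)) :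
    HasDerivAt (fun y => f (y, t)) (fderiv ℝ f (x, t) (1, 0)) x :=
  hf.hasFDerivAt.comp_hasDerivAt x ((hasDerivAt_id x).prodMk (hasDerivAt_const x t))

lemma hasDerivAt_slice_snd {f : ℝ × ℝ → ℝ} {x t : ℝ} (hf : DifferentiableAt ℝ f (x, t)) :
    HasDerivAt (fun s => f (x, s)) (fderiv ℝ f (x, t) (0, 1)) t :=
  hf.hasFDerivAt.comp_hasDerivAt t ((hasDerivAt_const t x).prodMk (hasDerivAt_id t))

lemma pdx_eq_fderiv {f : ℝ × ℝ → ℝ} (hf : Differentiable ℝ f) (x t : ℝ) :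
    pdx f x t = fderiv ℝ f (x, t) (1, 0) :=
  (hasDerivAt_slice_fst (hf _)).deriv

lemma pdt_eq_fderiv {f : ℝ × ℝ → ℝ} (hf : Differentiable ℝ f) (x t : ℝ) :
    pdt f x t = fderiv ℝ f (x, t) (0, 1) :=
  (hasDerivAt_slice_snd (hf _)).deriv

lemma differentiable_fderiv_apply {f : ℝ × ℝ → ℝ} (hf : ContDiff ℝ 2 f) (v : ℝ × ℝ) :
    Differentiable ℝ (fun p => fderiv ℝ f p v) :=
  ((hf.fderiv_right (m := 1) (by norm_num)).differentiable (by norm_num)).clm_apply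
    (differentiable_const v)

lemma differentiable_pdx {f : ℝ × ℝ → ℝ} (hf : ContDiff ℝ 2 f) :
    Differentiable ℝ (fun p : ℝ × ℝ => pdx f p.1 p.2) := by
  simpa only [pdx_eq_fderiv (hf.differentiable (by norm_num))] using
    differentiable_fderiv_apply hf (1, 0)

/-- Mixed partial derivatives commute: `∂ₜ∂ₓf = ∂ₓ∂ₜf`. -/
lemma hasDerivAt_pdx_snd {f : ℝ × ℝ → ℝ} (hf : ContDiff ℝ 2 f) (x t : ℝ) :
    HasDerivAt (fun s => pdx f x s) (deriv (fun y => pdt f y t) x) t := by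
  have hd : Differentiable ℝ f := hf.differentiable (by norm_num)
  have hd' : DifferentiableAt ℝ (fderiv ℝ f) (x, t) :=
    (hf.fderiv_right (m := 1) (by norm_num)).differentiable (by norm_num) _
  have hsymm : IsSymmSndFDerivAt ℝ f (x, t) :=
    hf.contDiffAt.isSymmSndFDerivAt (by simp)
  have key (v w : ℝ × ℝ) :
      fderiv ℝ (fun p => fderiv ℝ f p v) (x, t) w = fderiv ℝ (fderiv ℝ f) (x, t) w v := by
    rw [fderiv_clm_apply hd' (differentiableAt_const v)]
    simp
  simp only [pdx_eq_fderiv hd, pdt_eq_fderiv hd]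
  rw [(hasDerivAt_slice_fst (differentiable_fderiv_apply hf (0, 1) (x, t))).deriv, key,
    hsymm.eq, ← key]
  exact hasDerivAt_slice_snd (differentiable_fderiv_apply hf (1, 0) (x, t))

lemma eq_zero_time_of_hasDerivAt_zero {g : ℝ → ℝ} (hg : ∀ s, 0 ≤ s → HasDerivAt g 0 s)
    {t : ℝ} (ht : 0 ≤ t) : g t = g 0 :=
  constant_of_has_deriv_right_zero
    (fun s hs => (hg s hs.1).continuousAt.continuousWithinAt)
    (fun s hs => (hg s hs.1).hasDerivWithinAt) t ⟨ht, le_rfl⟩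

/-- The identities established in the proof of Lemma 2.1: `∂ₓJ` is constant in
time and `ρ` is affine in time. -/
theorem momentum_gradient_constant_and_density_affine
    (ρ J S φ : ℝ × ℝ → ℝ)
    (hρ : ContDiff ℝ 3 ρ) (hJ : ContDiff ℝ 3 J) (hS : ContDiff ℝ 3 S)
    (hφ : ContDiff ℝ 3 φ)
    (hcont : ∀ x t : ℝ, 0 ≤ t → pdt ρ x t + pdx J x t = 0)
    (hmom : ∀ x t : ℝ, 0 ≤ t → pdt J x t + pdx S x t = ρ (x, t) * pdx φ x t)
    (hpois : ∀ x t : ℝ, 0 ≤ t →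
      pdx (fun p => ρ p * pdx φ p.1 p.2) x t = pdxx S x t) :
    ∀ x t : ℝ, 0 ≤ t →
      pdx J x t = pdx J x 0 ∧ ρ (x, t) = ρ (x, 0) - t * pdx J x 0 := by
  have hρd : Differentiable ℝ ρ := hρ.differentiable (by norm_num)
  have hJ2 : ContDiff ℝ 2 J := hJ.of_le (by norm_num)
  have hS2 : ContDiff ℝ 2 S := hS.of_le (by norm_num)
  have hφ2 : ContDiff ℝ 2 φ := hφ.of_le (by norm_num)
  have hmixed (x t : ℝ) (ht : 0 ≤ t) : deriv (fun y => pdt J y t) x = 0 := by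
    have hfun : (fun y => pdt J y t) = fun y => ρ (y, t) * pdx φ y t - pdx S y t := by
      funext y
      linarith [hmom y t ht]
    have hforce : DifferentiableAt ℝ (fun y => ρ (y, t) * pdx φ y t) x :=
      (hasDerivAt_slice_fst ((hρd.mul (differentiable_pdx hφ2)) (x, t))).differentiableAt
    have hstress : DifferentiableAt ℝ (fun y => pdx S y t) x :=
      (hasDerivAt_slice_fst (differentiable_pdx hS2 (x, t))).differentiableAt
    rw [hfun, deriv_fun_sub hforce hstress]
    exact sub_eq_zero.mpr (hpois x t ht)
  have hgrad (x t : ℝ) (ht : 0 ≤ t) : pdx J x t = pdx J x 0 :=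
    eq_zero_time_of_hasDerivAt_zero (g := fun s => pdx J x s)
      (fun s hs => hmixed x s hs ▸ hasDerivAt_pdx_snd hJ2 x s) ht
  intro x t ht
  refine ⟨hgrad x t ht, ?_⟩
  have haffine : ρ (x, t) + t * pdx J x 0 = ρ (x, 0) + 0 * pdx J x 0 := by
    refine eq_zero_time_of_hasDerivAt_zero (g := fun s => ρ (x, s) + s * pdx J x 0)
      (fun s hs => ?_) ht
    have h := (hasDerivAt_slice_snd (hρd (x, s))).add
      ((hasDerivAt_id s).mul_const (pdx J x 0))
    rwa [one_mul, ← pdt_eq_fderiv hρd, ← hgrad x s hs, hcont x s hs, hgrad x s hs] at h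
  linarith
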